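/- arXiv:math/0602096 — 2 statements merged into one kernel-verified Lean document; each statement's English description precedes it below -/
import Mathlib

section
/- Let q = p^r with p prime, and let L be a field containing 𝔽_q. Let W ⊆ L be a finite-dimensional 𝔽_q-linear subspace of L (for the scalar multiplication coming from 𝔽_q ⊆ L). Then the polynomial P_W(X) = ∏_{w ∈ W} (X − w) ∈ L[X] is a q-linearized additive polynomial: P_W(X) = ∑_{i=0}^{dim W} c_i X^{q^i} for some c_i ∈ L with c_{dim W} = 1; equivalently, for all x, y in any commutative L-algebra and all λ ∈ 𝔽_q one has P_W(x + y) = P_W(x) + P_W(y) and P_W(λ x) = λ P_W(x). -/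
open Polynomial

section LinearizedPolynomial

variable {F L : Type*} [Field F] [Field L] [Algebra F L]

/-- A polynomial of degree less than `#W` vanishing on `W` is zero. -/
theorem Submodule.eq_zero_of_degree_lt_card_of_eval_eq_zero (W : Submodule F L) [Fintype W]
    {f : L[X]} (hf : f.degree < (Fintype.card W : WithBot ℕ))
    (h : ∀ w : W, f.eval (w : L) = 0) : f = 0 := by
  refine eq_zero_of_degree_lt_of_eval_index_eq_zero (v := fun w : W => (w : L)) (s := Finset.univ)
    Subtype.val_injective.injOn ?_ fun w _ => h w
  simpa using hf

variable [Fintype F]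

/-- The `F`-linear map `w ↦ w ^ (q ^ i)` from a subspace `W` of `L` to `L`, where `q = #F`. -/
noncomputable def Submodule.frobeniusPow (W : Submodule F L) (i : ℕ) : W →ₗ[F] L :=
  ((FiniteField.frobeniusAlgHom F L) ^ i).toLinearMap ∘ₗ W.subtype

theorem Submodule.frobeniusPow_apply (W : Submodule F L) (i : ℕ) (w : W) :
    W.frobeniusPow i w = (w : L) ^ (Fintype.card F ^ i) := by
  simp [Submodule.frobeniusPow, AlgHom.coe_pow, FiniteField.coe_frobeniusAlgHom, pow_iterate]

theorem Submodule.degree_sum_C_mul_X_pow_card_pow_lt (W : Submodule F L) [Fintype W]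
    (c : Fin (Module.finrank F W) → L) :
    (∑ i, C (c i) * X ^ (Fintype.card F ^ (i : ℕ))).degree < (Fintype.card W : WithBot ℕ) := by
  rw [Module.card_eq_pow_finrank (K := F) (V := W), ← mem_degreeLT]
  refine Submodule.sum_mem _ fun i _ => mem_degreeLT.mpr ?_
  refine (degree_C_mul_X_pow_le _ _).trans_lt ?_
  exact_mod_cast Nat.pow_lt_pow_right Fintype.one_lt_card i.2

theorem Submodule.linearIndependent_frobeniusPow (W : Submodule F L) [Fintype W] :
    LinearIndependent L fun i : Fin (Module.finrank F W) => W.frobeniusPow i := by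
  rw [Fintype.linearIndependent_iff]
  intro c hc i
  have h := W.eq_zero_of_degree_lt_card_of_eval_eq_zero
    (W.degree_sum_C_mul_X_pow_card_pow_lt c) fun w => by
      simpa [eval_finsetSum, W.frobeniusPow_apply] using LinearMap.congr_fun hc w
  have h' := congrArg (coeff · (Fintype.card F ^ (i : ℕ))) h
  simpa [finsetSum_coeff, coeff_X_pow, Nat.pow_right_inj (Fintype.one_lt_card (α := F)),
    Fin.val_inj] using h'

theorem Submodule.exists_frobeniusPow_finrank_eq_sum (W : Submodule F L) [Fintype W] :
    ∃ c : Fin (Module.finrank F W) → L,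
      ∑ i, c i • W.frobeniusPow i = W.frobeniusPow (Module.finrank F W) := by
  rw [← Submodule.mem_span_range_iff_exists_fun,
    W.linearIndependent_frobeniusPow.span_eq_top_of_card_eq_finrank']
  · trivial
  · rw [Fintype.card_fin, Module.finrank_linearMap_self]

end LinearizedPolynomial

/-- For a finite-dimensional `𝔽_q`-subspace `W` of a field `L ⊇ 𝔽_q`, the polynomial
`P_W(X) = ∏_{w ∈ W} (X − w)` is a monic `q`-linearized additive polynomial:
`P_W = ∑_{i=0}^{dim W} c_i X^{q^i}` with `c_{dim W} = 1`. -/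
theorem stmt_4 {F : Type*} [Field F] [Fintype F] {L : Type*} [Field L] [Algebra F L]
    (W : Submodule F L) [Fintype W] :
    ∃ c : ℕ → L, c (Module.finrank F W) = 1 ∧
      ∏ w : W, (X - C (w : L)) =
        ∑ i ∈ Finset.range (Module.finrank F W + 1),
          C (c i) * X ^ (Fintype.card F ^ i) := by
  obtain ⟨a, ha⟩ := W.exists_frobeniusPow_finrank_eq_sum
  refine ⟨fun i => if h : i < Module.finrank F W then -a ⟨i, h⟩ else 1, by simp, ?_⟩
  rw [Finset.sum_range_succ, Finset.sum_range]
  simp only [Fin.is_lt, dite_true, Fin.eta, lt_irrefl, dite_false, C_1, one_mul]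
  have hcard : Fintype.card W = Fintype.card F ^ Module.finrank F W :=
    Module.card_eq_pow_finrank
  have hprod : (∏ w : W, (X - C (w : L))).degree = (Fintype.card W : WithBot ℕ) := by
    simp [degree_prod]
  have hmonic : (∏ w : W, (X - C (w : L))).Monic := monic_prod_X_sub_C _ _
  rw [← sub_eq_zero]
  refine W.eq_zero_of_degree_lt_card_of_eval_eq_zero ?_ fun w => ?_
  · rw [add_comm, ← sub_sub]
    refine (degree_sub_le _ _).trans_lt (max_lt ?_
      (W.degree_sum_C_mul_X_pow_card_pow_lt fun i => -a i))
    rw [← hprod]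
    refine degree_sub_lt_left ?_ hmonic.ne_zero ?_
    · rw [hprod, hcard, degree_X_pow]
    · rw [hmonic.leadingCoeff, (monic_X_pow _).leadingCoeff]
  · have hw := LinearMap.congr_fun ha w
    simp only [LinearMap.sum_apply, LinearMap.smul_apply, W.frobeniusPow_apply,
      smul_eq_mul] at hw
    have hz : (∏ v : W, (X - C (v : L))).eval (w : L) = 0 := by
      rw [eval_prod]
      exact Finset.prod_eq_zero (Finset.mem_univ w) (by simp)
    simp [hz, eval_finsetSum, hw]
end

section
/- Let A be the free abelian group on the set of finite words over the two-letter alphabet {←, →} (including the empty word). For words u, v define u ∗ v := (u·→·v) + (u·←·v) ∈ A, where · is concatenation, and extend ∗ bi-additively to A. Write ←^a (resp. →^a) for the word consisting of a copies of ← (resp. →), and juxtaposition for concatenation. Then for all integers 1 ≤ l < s: ∑_{r=0}^{s−l−1} (−1)^r (←^{l−1} →^r) ∗ (←^{s−l−r−1}) = (←^{s−1}) + (−1)^{s−l−1} (←^{l−1} →^{s−l}) in A. -/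
/-- Words over the alphabet `{←, →}`: `false` stands for `←`, `true` for `→`.
`wordStar u v = u→v + u←v` in the free abelian group on words. -/
def wordStar (u v : List Bool) : FreeAbelianGroup (List Bool) :=
  FreeAbelianGroup.of (u ++ [true] ++ v) + FreeAbelianGroup.of (u ++ [false] ++ v)

/-- A signed sum of consecutive pairs telescopes. -/
theorem sum_neg_one_pow_zsmul_succ_add {A : Type*} [AddCommGroup A] (g : ℕ → A) (n : ℕ) :
    ∑ r ∈ Finset.range (n + 1), ((-1 : ℤ) ^ r) • (g (r + 1) + g r) =
      g 0 + ((-1 : ℤ) ^ n) • g (n + 1) := by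
  induction n with
  | zero => simp [add_comm]
  | succ n ih =>
    rw [Finset.sum_range_succ, ih, pow_succ, mul_neg_one, neg_smul, neg_smul, smul_add]
    abel

/-- Each product with a constant word `←^{n-r-1}` is a sum of two consecutive words
`w →^r ←^{n-r}`. -/
theorem wordStar_append_replicate (w : List Bool) {n r : ℕ} (hr : r < n) :
    wordStar (w ++ List.replicate r true) (List.replicate (n - r - 1) false) =
      FreeAbelianGroup.of
          (w ++ List.replicate (r + 1) true ++ List.replicate (n - (r + 1)) false) +
        FreeAbelianGroup.of (w ++ List.replicate r true ++ List.replicate (n - r) false) := by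
  obtain ⟨m, rfl⟩ := Nat.exists_eq_add_of_lt hr
  have h₁ : r + m + 1 - r = m + 1 := by lia
  have h₂ : r + m + 1 - (r + 1) = m := by lia
  rw [h₁, h₂, List.replicate_succ' (n := r)]
  simp [wordStar, List.replicate_succ (n := m)]

/-- For `1 ≤ l < s`:
`∑_{r=0}^{s−l−1} (−1)^r (←^{l−1} →^r) ∗ (←^{s−l−r−1})
  = (←^{s−1}) + (−1)^{s−l−1} (←^{l−1} →^{s−l})`. -/
theorem stmt_11 (s l : ℕ) (hl : 1 ≤ l) (hls : l < s) :
    (∑ r ∈ Finset.range (s - l), ((-1 : ℤ) ^ r) •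
        wordStar (List.replicate (l - 1) false ++ List.replicate r true)
          (List.replicate (s - l - r - 1) false)) =
      FreeAbelianGroup.of (List.replicate (s - 1) false) +
        ((-1 : ℤ) ^ (s - l - 1)) •
          FreeAbelianGroup.of
            (List.replicate (l - 1) false ++ List.replicate (s - l) true) := by
  obtain ⟨n, rfl⟩ := Nat.exists_eq_add_of_lt hls
  have h₁ : l + n + 1 - l = n + 1 := by lia
  have h₂ : l + n + 1 - 1 = l - 1 + (n + 1) := by lia
  rw [h₁, h₂, Finset.sum_congr rfl fun r hr =>
    congrArg _ (wordStar_append_replicate _ (Finset.mem_range.mp hr)),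
    sum_neg_one_pow_zsmul_succ_add fun r => FreeAbelianGroup.of
      (List.replicate (l - 1) false ++ List.replicate r true ++
        List.replicate (n + 1 - r) false)]
  simp [List.replicate_append_replicate]
end
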